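/- arXiv:1911.01743 — 7 statements merged into one kernel-verified Lean document; each statement's English description precedes it below -/
import Mathlib

section
/- For every positive integer n, the unitary cyclotomic polynomial factors into cyclotomic polynomials as Φ*_n(x) = ∏_{d ∣ n, κ(d) = κ(n)} Φ_d(x), where the product runs over all positive divisors d of n whose squarefree kernel equals that of n. -/
open Polynomial Finset

/-- The finset of unitary divisors of `n`: divisors `d` of `n` with `gcd (d, n / d) = 1`. -/
def unitaryDivisors (n : ℕ) : Finset ℕ :=
  n.divisors.filter fun d => Nat.Coprime d (n / d)

/-- `d ∣∣ n`: `d` is a unitary divisor of `n`. -/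
def IsUnitaryDivisor (d n : ℕ) : Prop := d ∈ unitaryDivisors n

/-- `(j, n)_*`: the greatest `d` such that `d ∣ j` and `d` is a unitary divisor of `n`. -/
def unitaryGcd (j n : ℕ) : ℕ :=
  ((unitaryDivisors n).filter fun d => d ∣ j).sup id

/-- `κ(n)`: the squarefree kernel (radical) of `n`. -/
def kernel (n : ℕ) : ℕ := ∏ p ∈ n.primeFactors, p

/-- `φ*(n)`: the unitary Euler totient function. -/
def unitaryTotient (n : ℕ) : ℕ :=
  ((Finset.Icc 1 n).filter fun j => unitaryGcd j n = 1).card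

/-- `μ*(n) = (-1)^{ω(n)}`: the unitary Moebius function. -/
def unitaryMoebius (n : ℕ) : ℤ := (-1) ^ n.primeFactors.card

/-- `Φ*_n`: the unitary cyclotomic polynomial (over `ℂ`). -/
noncomputable def unitaryCyclotomic (n : ℕ) : Polynomial ℂ :=
  ∏ j ∈ (Finset.Icc 1 n).filter fun j => unitaryGcd j n = 1,
    (X - C (Complex.exp (2 * (Real.pi : ℂ) * Complex.I * (j : ℂ) / (n : ℂ))))

/-- `c*_n(k)`: the unitary Ramanujan sum. -/
noncomputable def unitaryRamanujan (n k : ℕ) : ℂ :=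
  ∑ j ∈ (Finset.Icc 1 n).filter fun j => unitaryGcd j n = 1,
    Complex.exp (2 * (Real.pi : ℂ) * Complex.I * (j : ℂ) * (k : ℂ) / (n : ℂ))

/-- `c_n(k)`: the classical Ramanujan sum. -/
noncomputable def ramanujanSum (n k : ℕ) : ℂ :=
  ∑ j ∈ (Finset.Icc 1 n).filter fun j => Nat.Coprime j n,
    Complex.exp (2 * (Real.pi : ℂ) * Complex.I * (j : ℂ) * (k : ℂ) / (n : ℂ))

/-- The unitary convolution `(f × g)(n) = ∑_{d ∣∣ n} f(d) g(n/d)`. -/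
noncomputable def unitaryConv (f g : ℕ → ℂ) (n : ℕ) : ℂ :=
  ∑ d ∈ unitaryDivisors n, f d * g (n / d)

/-- `Λ*(n)`: the unitary von Mangoldt function, `a log p` for `n = p^a`, else `0`. -/
noncomputable def unitaryVonMangoldt (n : ℕ) : ℝ :=
  if IsPrimePow n then (n.factorization n.minFac : ℝ) * Real.log n.minFac else 0

/-- The squarefree kernel determines, and is determined by, the set of prime factors. -/
theorem kernel_eq_kernel_iff {m n : ℕ} : kernel m = kernel n ↔ m.primeFactors = n.primeFactors := by
  refine ⟨fun h => ?_, fun h => by simp only [kernel, h]⟩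
  have := congrArg Nat.primeFactors h
  rwa [kernel, kernel, Nat.primeFactors_prod fun p hp => Nat.prime_of_mem_primeFactors hp,
    Nat.primeFactors_prod fun p hp => Nat.prime_of_mem_primeFactors hp] at this

theorem unitaryGcd_eq_one_iff {j n : ℕ} (hn : n ≠ 0) :
    unitaryGcd j n = 1 ↔ ∀ d ∈ unitaryDivisors n, d ∣ j → d = 1 := by
  have h_one : 1 ∈ (unitaryDivisors n).filter fun d => d ∣ j := by
    simp [unitaryDivisors, hn]
  constructor
  · intro h d hd hdj
    have h_le : d ≤ unitaryGcd j n := Finset.le_sup (f := id) (Finset.mem_filter.2 ⟨hd, hdj⟩)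
    have h_pos : 0 < d := Nat.pos_of_mem_divisors (Finset.mem_filter.1 hd).1
    omega
  · intro h
    refine le_antisymm (Finset.sup_le fun d hd => ?_) (Finset.le_sup (f := id) h_one)
    rw [Finset.mem_filter] at hd
    exact (h d hd.1 hd.2).le

theorem unitaryGcd_eq_one_iff_kernel_div_gcd {j n : ℕ} (hn : n ≠ 0) :
    unitaryGcd j n = 1 ↔ kernel (n / n.gcd j) = kernel n := by
  have h_gcd : n.gcd j ∣ n := Nat.gcd_dvd_left n j
  have h_div : n / n.gcd j ∣ n := Nat.div_dvd_of_dvd h_gcd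
  rw [unitaryGcd_eq_one_iff hn, kernel_eq_kernel_iff]
  constructor
  · intro h
    refine (Nat.primeFactors_mono h_div hn).antisymm fun p hp => ?_
    obtain ⟨hp, hpn, -⟩ := Nat.mem_primeFactors.1 hp
    refine Nat.mem_primeFactors.2 ⟨hp, ?_, ne_zero_of_dvd_ne_zero hn h_div⟩
    by_contra h_not
    have h_cop : Nat.Coprime (p ^ n.factorization p) (n / n.gcd j) :=
      ((Nat.Prime.coprime_iff_not_dvd hp).2 h_not).pow_left _
    have h_unitary : p ^ n.factorization p ∈ unitaryDivisors n :=
      Finset.mem_filter.2 ⟨Nat.mem_divisors.2 ⟨Nat.ordProj_dvd n p, hn⟩,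
        (Nat.coprime_ordCompl hp hn).pow_left _⟩
    have h_dvd : p ^ n.factorization p ∣ n.gcd j := by
      refine h_cop.dvd_of_dvd_mul_right ?_
      rw [Nat.mul_div_cancel' h_gcd]
      exact Nat.ordProj_dvd n p
    have h_eq := h _ h_unitary (h_dvd.trans (Nat.gcd_dvd_right n j))
    have h_fac := hp.factorization_pos_of_dvd hn hpn
    exact absurd h_eq (Nat.one_lt_pow h_fac.ne' hp.one_lt).ne'
  · intro h d hd hdj
    obtain ⟨hdn, h_cop⟩ := Finset.mem_filter.1 hd
    have hdn := Nat.dvd_of_mem_divisors hdn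
    by_contra hd_one
    obtain ⟨p, hp, hpd⟩ := Nat.exists_prime_and_dvd hd_one
    have hp_mem : p ∈ (n / n.gcd j).primeFactors :=
      h ▸ Nat.mem_primeFactors.2 ⟨hp, hpd.trans hdn, hn⟩
    have h_dvd : p ∣ n / d := (Nat.dvd_of_mem_primeFactors hp_mem).trans
      (Nat.div_dvd_div_left h_gcd (Nat.dvd_gcd hdn hdj))
    exact Nat.not_coprime_of_dvd_of_dvd hp.one_lt hpd h_dvd h_cop

/-- `Φ*_n(x) = ∏_{d ∣ n, κ(d) = κ(n)} Φ_d(x)`. -/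
theorem unitaryCyclotomic_eq_prod_cyclotomic (n : ℕ) (hn : 0 < n) :
    unitaryCyclotomic n =
      ∏ d ∈ n.divisors.filter fun d => kernel d = kernel n, Polynomial.cyclotomic d ℂ := by
  set ζ : ℂ := Complex.exp (2 * Real.pi * Complex.I / n) with hζ
  have h_prim : IsPrimitiveRoot ζ n := Complex.isPrimitiveRoot_exp n hn.ne'
  have h_exp (j : ℕ) : Complex.exp (2 * (Real.pi : ℂ) * Complex.I * (j : ℂ) / (n : ℂ)) = ζ ^ j := by
    rw [hζ, ← Complex.exp_nat_mul]
    ring_nf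
  have h_order (j : ℕ) : orderOf (ζ ^ j) = n / n.gcd j := by
    have h_fin : IsOfFinOrder ζ := isOfFinOrder_iff_pow_eq_one.2 ⟨n, hn, h_prim.pow_eq_one⟩
    rw [h_fin.orderOf_pow, ← h_prim.eq_orderOf]
  have h_cyc : ∀ d ∈ n.divisors.filter fun d => kernel d = kernel n,
      cyclotomic d ℂ = ∏ μ ∈ primitiveRoots d ℂ, (X - C μ) := fun d hd =>
    cyclotomic_eq_prod_X_sub_primitiveRoots (Complex.isPrimitiveRoot_exp d
      (Nat.pos_of_mem_divisors (Finset.mem_filter.1 hd).1).ne')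
  rw [Finset.prod_congr rfl h_cyc, ← Finset.prod_biUnion fun d _ e _ hde =>
    IsPrimitiveRoot.disjoint hde]
  simp only [unitaryCyclotomic, h_exp]
  refine Finset.prod_bij (fun j _ => ζ ^ j) (fun j hj => ?_) (fun i hi j hj hij => ?_)
    (fun μ hμ => ?_) fun _ _ => rfl
  · have h_unit := (unitaryGcd_eq_one_iff_kernel_div_gcd hn.ne').1 (Finset.mem_filter.1 hj).2
    have h_div : n / n.gcd j ∣ n := Nat.div_dvd_of_dvd (Nat.gcd_dvd_left n j)
    refine Finset.mem_biUnion.2 ⟨n / n.gcd j, Finset.mem_filter.2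
      ⟨Nat.mem_divisors.2 ⟨h_div, hn.ne'⟩, h_unit⟩, ?_⟩
    rw [mem_primitiveRoots (Nat.pos_of_dvd_of_pos h_div hn), ← h_order]
    exact IsPrimitiveRoot.orderOf _
  · simp only [Finset.mem_filter, Finset.mem_Icc] at hi hj
    have h_pow : ζ ^ (i - 1) = ζ ^ (j - 1) := by
      refine mul_right_cancel₀ (h_prim.ne_zero hn.ne') ?_
      rwa [← pow_succ, ← pow_succ, Nat.sub_add_cancel hi.1.1, Nat.sub_add_cancel hj.1.1]
    have := h_prim.pow_inj (by omega) (by omega) h_pow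
    omega
  · obtain ⟨d, hd, hμ⟩ := Finset.mem_biUnion.1 hμ
    obtain ⟨hd, h_ker⟩ := Finset.mem_filter.1 hd
    have hμ := (mem_primitiveRoots (Nat.pos_of_mem_divisors hd)).1 hμ
    have : NeZero n := ⟨hn.ne'⟩
    have h_pow : μ ^ n = 1 := hμ.pow_eq_one_iff_dvd n |>.2 (Nat.dvd_of_mem_divisors hd)
    obtain ⟨j, hj_mem, hj⟩ : ∃ j ∈ Finset.Icc 1 n, ζ ^ j = μ := by
      obtain ⟨i, hi, rfl⟩ := h_prim.eq_pow_of_pow_eq_one h_pow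
      rcases Nat.eq_zero_or_pos i with rfl | h_pos
      · exact ⟨n, Finset.mem_Icc.2 ⟨hn, le_rfl⟩, by rw [h_prim.pow_eq_one, pow_zero]⟩
      · exact ⟨i, Finset.mem_Icc.2 ⟨h_pos, hi.le⟩, rfl⟩
    refine ⟨j, Finset.mem_filter.2 ⟨hj_mem, ?_⟩, hj⟩
    rwa [unitaryGcd_eq_one_iff_kernel_div_gcd hn.ne', ← h_order, hj, ← hμ.eq_orderOf]
end

section
/- For every positive integer n, one has the factorization x^n − 1 = ∏_{d ∣∣ n} Φ*_d(x), where the product runs over all unitary divisors d of n. -/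
open Polynomial Finset

theorem mem_unitaryDivisors_iff {d n : ℕ} (hn : n ≠ 0) :
    d ∈ unitaryDivisors n ↔ ∃ e, d * e = n ∧ Nat.Coprime d e := by
  simp only [unitaryDivisors, Finset.mem_filter, Nat.mem_divisors]
  constructor
  · rintro ⟨⟨hd, -⟩, hc⟩
    exact ⟨n / d, Nat.mul_div_cancel' hd, hc⟩
  · rintro ⟨e, rfl, hc⟩
    have hd : 0 < d := Nat.pos_of_ne_zero (left_ne_zero_of_mul hn)
    exact ⟨⟨dvd_mul_right d e, hn⟩, by rwa [Nat.mul_div_cancel_left e hd]⟩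

theorem pos_of_mem_unitaryDivisors {d n : ℕ} (hd : d ∈ unitaryDivisors n) : 0 < d :=
  Nat.pos_of_mem_divisors (Finset.mem_filter.1 hd).1

theorem one_mem_unitaryDivisors {n : ℕ} (hn : n ≠ 0) : 1 ∈ unitaryDivisors n :=
  (mem_unitaryDivisors_iff hn).2 ⟨n, one_mul n, Nat.coprime_one_left n⟩

theorem div_mem_unitaryDivisors {d n : ℕ} (hd : d ∈ unitaryDivisors n) :
    n / d ∈ unitaryDivisors n := by
  have hn : n ≠ 0 := (Nat.mem_divisors.1 (Finset.mem_filter.1 hd).1).2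
  have hpos := pos_of_mem_unitaryDivisors hd
  obtain ⟨e, rfl, hc⟩ := (mem_unitaryDivisors_iff hn).1 hd
  rw [Nat.mul_div_cancel_left e hpos]
  exact (mem_unitaryDivisors_iff hn).2 ⟨d, mul_comm e d, hc.symm⟩

theorem div_div_self_of_mem_unitaryDivisors {d n : ℕ} (hd : d ∈ unitaryDivisors n) :
    n / (n / d) = d :=
  have h := Nat.mem_divisors.1 (Finset.mem_filter.1 hd).1
  Nat.div_div_self h.1 h.2

theorem le_unitaryGcd {d j n : ℕ} (hd : d ∈ unitaryDivisors n) (hj : d ∣ j) :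
    d ≤ unitaryGcd j n :=
  Finset.le_sup (f := id) (Finset.mem_filter.2 ⟨hd, hj⟩)

theorem unitaryGcd_mem_filter {n : ℕ} (j : ℕ) (hn : n ≠ 0) :
    unitaryGcd j n ∈ (unitaryDivisors n).filter fun d => d ∣ j := by
  obtain ⟨d, hd, h⟩ := Finset.exists_mem_eq_sup ((unitaryDivisors n).filter fun d => d ∣ j)
    ⟨1, Finset.mem_filter.2 ⟨one_mem_unitaryDivisors hn, one_dvd j⟩⟩ id
  rw [unitaryGcd, h]
  exact hd

theorem unitaryGcd_mem_unitaryDivisors {n : ℕ} (j : ℕ) (hn : n ≠ 0) :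
    unitaryGcd j n ∈ unitaryDivisors n :=
  (Finset.mem_filter.1 (unitaryGcd_mem_filter j hn)).1

theorem unitaryGcd_dvd {n : ℕ} (j : ℕ) (hn : n ≠ 0) : unitaryGcd j n ∣ j :=
  (Finset.mem_filter.1 (unitaryGcd_mem_filter j hn)).2

theorem gcd_mem_unitaryDivisors {d e m : ℕ} (hem : e * m ≠ 0) (hd : d ∈ unitaryDivisors (e * m)) :
    d.gcd m ∈ unitaryDivisors m := by
  obtain ⟨d', hdd', hc⟩ := (mem_unitaryDivisors_iff hem).1 hd
  refine (mem_unitaryDivisors_iff (right_ne_zero_of_mul hem)).2 ⟨d'.gcd m, ?_, ?_⟩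
  · rw [Nat.gcd_comm d, Nat.gcd_comm d', ← hc.gcd_mul m, hdd']
    exact Nat.gcd_eq_left (dvd_mul_left m e)
  · exact (hc.coprime_dvd_left (Nat.gcd_dvd_left d m)).coprime_dvd_right (Nat.gcd_dvd_left d' m)

theorem mul_mem_unitaryDivisors {d e m : ℕ} (hem : e * m ≠ 0) (hc : Nat.Coprime e m)
    (hd : d ∈ unitaryDivisors m) : e * d ∈ unitaryDivisors (e * m) := by
  obtain ⟨d', rfl, hdd'⟩ := (mem_unitaryDivisors_iff (right_ne_zero_of_mul hem)).1 hd
  exact (mem_unitaryDivisors_iff hem).2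
    ⟨d', mul_assoc e d d', Nat.Coprime.mul_left (hc.coprime_dvd_right (dvd_mul_left d' d)) hdd'⟩

theorem unitaryGcd_mul_eq_left_iff {e m : ℕ} (k : ℕ) (hem : e * m ≠ 0) (hc : Nat.Coprime e m) :
    unitaryGcd (e * k) (e * m) = e ↔ unitaryGcd k m = 1 := by
  have hm : m ≠ 0 := right_ne_zero_of_mul hem
  have he : 0 < e := Nat.pos_of_ne_zero (left_ne_zero_of_mul hem)
  constructor
  · intro h
    have hle := le_unitaryGcd
      (mul_mem_unitaryDivisors hem hc (unitaryGcd_mem_unitaryDivisors k hm))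
      (mul_dvd_mul_left e (unitaryGcd_dvd k hm))
    rw [h] at hle
    have hpos := pos_of_mem_unitaryDivisors (unitaryGcd_mem_unitaryDivisors k hm)
    nlinarith
  · intro h
    refine le_antisymm (Nat.le_of_dvd he ?_)
      (le_unitaryGcd ((mem_unitaryDivisors_iff hem).2 ⟨m, rfl, hc⟩) (dvd_mul_right e k))
    have hmem := unitaryGcd_mem_unitaryDivisors (e * k) hem
    have hdvd := unitaryGcd_dvd (e * k) hem
    generalize unitaryGcd (e * k) (e * m) = d at hmem hdvd
    have hgcd : d.gcd m ∣ k :=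
      (hc.symm.coprime_dvd_left (Nat.gcd_dvd_right d m)).dvd_of_dvd_mul_left
        ((Nat.gcd_dvd_left d m).trans hdvd)
    have hmem' := gcd_mem_unitaryDivisors hem hmem
    have hle := le_unitaryGcd hmem' hgcd
    have hcop : d.Coprime m :=
      le_antisymm (h ▸ hle) (pos_of_mem_unitaryDivisors hmem')
    obtain ⟨d', hdd', -⟩ := (mem_unitaryDivisors_iff hem).1 hmem
    exact hcop.dvd_of_dvd_mul_right ⟨d', hdd'.symm⟩

theorem X_pow_sub_one_eq_prod_Icc_exp (n : ℕ) (hn : 0 < n) :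
    (X : Polynomial ℂ) ^ n - 1 = ∏ j ∈ Finset.Icc 1 n,
      (X - C (Complex.exp (2 * (Real.pi : ℂ) * Complex.I * (j : ℂ) / (n : ℂ)))) := by
  have hζ := Complex.isPrimitiveRoot_exp n hn.ne'
  have hpow (j : ℕ) : Complex.exp (2 * (Real.pi : ℂ) * Complex.I * (j : ℂ) / (n : ℂ)) =
      Complex.exp (2 * (Real.pi : ℂ) * Complex.I / (n : ℂ)) ^ j := by
    rw [← Complex.exp_nat_mul]
    congr 1
    ring
  simp only [hpow]
  generalize Complex.exp (2 * (Real.pi : ℂ) * Complex.I / (n : ℂ)) = ζ at hζ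
  rw [X_pow_sub_one_eq_prod hn hζ]
  symm
  refine Finset.prod_bij (fun j _ => ζ ^ j) ?_ ?_ ?_ fun _ _ => rfl
  · intro j _
    rw [mem_nthRootsFinset hn, ← pow_mul, mul_comm, pow_mul, hζ.pow_eq_one, one_pow]
  · intro i hi j hj hij
    rw [Finset.mem_Icc] at hi hj
    obtain ⟨i, rfl⟩ := Nat.exists_eq_add_of_le' hi.1
    obtain ⟨j, rfl⟩ := Nat.exists_eq_add_of_le' hj.1
    simp only [pow_succ] at hij
    rw [hζ.pow_inj hi.2 hj.2 (mul_right_cancel₀ (hζ.ne_zero hn.ne') hij)]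
  · intro z hz
    have : NeZero n := ⟨hn.ne'⟩
    obtain ⟨i, hi, rfl⟩ := hζ.eq_pow_of_pow_eq_one ((mem_nthRootsFinset hn _).1 hz)
    rcases Nat.eq_zero_or_pos i with rfl | hpos
    · exact ⟨n, Finset.mem_Icc.2 ⟨hn, le_rfl⟩, by rw [hζ.pow_eq_one, pow_zero]⟩
    · exact ⟨i, Finset.mem_Icc.2 ⟨hpos, hi.le⟩, rfl⟩

/-- The part of `X ^ (e * m) - 1` whose exponents `j` satisfy `(j, e * m)_* = e` is `Φ*_m`. -/
theorem prod_filter_unitaryGcd_eq_unitaryCyclotomic {e m : ℕ} (hem : e * m ≠ 0)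
    (hc : Nat.Coprime e m) :
    ∏ j ∈ (Finset.Icc 1 (e * m)).filter fun j => unitaryGcd j (e * m) = e,
      (X - C (Complex.exp (2 * (Real.pi : ℂ) * Complex.I * (j : ℂ) / ((e * m : ℕ) : ℂ)))) =
    unitaryCyclotomic m := by
  have he : 0 < e := Nat.pos_of_ne_zero (left_ne_zero_of_mul hem)
  symm
  refine Finset.prod_bij (fun k _ => e * k) ?_ ?_ ?_ ?_
  · intro k hk
    rw [Finset.mem_filter, Finset.mem_Icc] at hk ⊢
    exact ⟨⟨Nat.mul_pos he hk.1.1, Nat.mul_le_mul_left e hk.1.2⟩,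
      (unitaryGcd_mul_eq_left_iff k hem hc).2 hk.2⟩
  · exact fun _ _ _ _ h => Nat.eq_of_mul_eq_mul_left he h
  · intro j hj
    rw [Finset.mem_filter, Finset.mem_Icc] at hj
    obtain ⟨k, rfl⟩ : e ∣ j := hj.2 ▸ unitaryGcd_dvd j hem
    refine ⟨k, ?_, rfl⟩
    rw [Finset.mem_filter, Finset.mem_Icc]
    exact ⟨⟨Nat.pos_of_mul_pos_left hj.1.1, Nat.le_of_mul_le_mul_left hj.1.2 he⟩,
      (unitaryGcd_mul_eq_left_iff k hem hc).1 hj.2⟩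
  · intro k _
    have he' : (e : ℂ) ≠ 0 := Nat.cast_ne_zero.2 he.ne'
    rw [Nat.cast_mul, Nat.cast_mul, mul_left_comm, mul_div_mul_left _ _ he']

/-- `x^n - 1 = ∏_{d ∣∣ n} Φ*_d(x)`. -/
theorem X_pow_sub_one_eq_prod_unitaryCyclotomic (n : ℕ) (hn : 0 < n) :
    (X : Polynomial ℂ) ^ n - 1 = ∏ d ∈ unitaryDivisors n, unitaryCyclotomic d := by
  rw [X_pow_sub_one_eq_prod_Icc_exp n hn,
    ← Finset.prod_fiberwise_of_maps_to fun j _ => unitaryGcd_mem_unitaryDivisors j hn.ne']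
  refine Finset.prod_bij' (fun d _ => n / d) (fun d _ => n / d)
    (fun _ => div_mem_unitaryDivisors) (fun _ => div_mem_unitaryDivisors)
    (fun _ => div_div_self_of_mem_unitaryDivisors)
    (fun _ => div_div_self_of_mem_unitaryDivisors) fun e he => ?_
  have hpos := pos_of_mem_unitaryDivisors he
  obtain ⟨m, rfl, hc⟩ := (mem_unitaryDivisors_iff hn.ne').1 he
  rw [Nat.mul_div_cancel_left m hpos]
  exact prod_filter_unitaryGcd_eq_unitaryCyclotomic hn.ne' hc
end

section
/- For every positive integer n, Φ*_n(x) = ∏_{d ∣ n/κ(n)} Φ_{κ(n)}(x^d), where the product runs over all positive divisors d of n/κ(n). -/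
open Polynomial Finset

theorem kernel_pos (n : ℕ) : 0 < kernel n :=
  Finset.prod_pos fun _ hp => (Nat.prime_of_mem_primeFactors hp).pos

theorem kernel_dvd_iff {n : ℕ} (hn : n ≠ 0) (d : ℕ) :
    kernel n ∣ d ↔ ∀ p, p.Prime → p ∣ n → p ∣ d := by
  refine ⟨fun h p hp hpn => ?_, fun h => ?_⟩
  · exact (Finset.dvd_prod_of_mem (fun p => p)
      (Nat.mem_primeFactors.2 ⟨hp, hpn, hn⟩)).trans h
  · refine Finset.prod_primes_dvd _ (fun p hp => ?_) fun p hp => ?_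
    · exact (Nat.prime_of_mem_primeFactors hp).prime
    · exact h p (Nat.prime_of_mem_primeFactors hp) (Nat.dvd_of_mem_primeFactors hp)

theorem unitaryGcd_eq_one_iff_forall {n : ℕ} (hn : n ≠ 0) (j : ℕ) :
    unitaryGcd j n = 1 ↔ ∀ d ∈ unitaryDivisors n, d ∣ j → d = 1 := by
  have one_mem : 1 ∈ (unitaryDivisors n).filter fun d => d ∣ j := by
    simp [unitaryDivisors, hn]
  constructor
  · intro h d hd hdj
    have hle : d ≤ 1 := h ▸ Finset.le_sup (f := id) (Finset.mem_filter.2 ⟨hd, hdj⟩)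
    have hpos : 0 < d := Nat.pos_of_mem_divisors (Finset.mem_filter.1 hd).1
    omega
  · intro h
    refine le_antisymm (Finset.sup_le fun d hd => ?_) (Finset.le_sup (f := id) one_mem)
    exact (h d (Finset.mem_filter.1 hd).1 (Finset.mem_filter.1 hd).2).le

theorem unitaryGcd_eq_one_iff_kernel_dvd {n : ℕ} (hn : n ≠ 0) (j : ℕ) :
    unitaryGcd j n = 1 ↔ kernel n ∣ n / n.gcd j := by
  rw [unitaryGcd_eq_one_iff_forall hn, kernel_dvd_iff hn]
  constructor
  · intro h p hp hpn
    by_contra hnot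
    have hmem : ordProj[p] n ∈ unitaryDivisors n := by
      refine Finset.mem_filter.2 ⟨Nat.mem_divisors.2 ⟨Nat.ordProj_dvd n p, hn⟩, ?_⟩
      exact (Nat.coprime_ordCompl hp hn).pow_left _
    have hdvd : ordProj[p] n ∣ n.gcd j * (n / n.gcd j) := by
      rw [Nat.mul_div_cancel' (Nat.gcd_dvd_left n j)]
      exact Nat.ordProj_dvd n p
    have hcop : (ordProj[p] n).Coprime (n / n.gcd j) :=
      ((Nat.Prime.coprime_iff_not_dvd hp).2 hnot).pow_left _
    have hone := h _ hmem ((hcop.dvd_of_dvd_mul_right hdvd).trans (Nat.gcd_dvd_right n j))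
    have hp1 : p ∣ ordProj[p] n :=
      dvd_pow_self p (hp.factorization_pos_of_dvd hn hpn).ne'
    rw [hone] at hp1
    exact hp.one_lt.ne' (Nat.dvd_one.1 hp1)
  · intro h d hd hdj
    obtain ⟨hdn, hcop⟩ := Finset.mem_filter.1 hd
    by_contra hne
    obtain ⟨p, hp, hpd⟩ := Nat.exists_prime_and_dvd hne
    have hdn := Nat.dvd_of_mem_divisors hdn
    have hdiv : n / n.gcd j ∣ n / d :=
      Nat.div_dvd_div_left (Nat.gcd_dvd_left n j) (Nat.dvd_gcd hdn hdj)
    exact Nat.not_coprime_of_dvd_of_dvd hp.one_lt hpd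
      ((h p hp (hpd.trans hdn)).trans hdiv) hcop

theorem cyclotomic_comp_X_pow {R : Type*} [CommRing R] (m : ℕ) {e : ℕ} (he : e ≠ 0)
    (h : ∀ p, p.Prime → p ∣ e → p ∣ m) :
    (cyclotomic m R).comp (X ^ e) = cyclotomic (m * e) R := by
  rw [← expand_eq_comp_X_pow]
  induction e using induction_on_primes with
  | zero => exact absurd rfl he
  | one => simp
  | prime_mul p a hp ih =>
    rw [expand_mul, ih (right_ne_zero_of_mul he) fun q hq hqa => h q hq (hqa.mul_left p),
      cyclotomic_expand_eq_cyclotomic hp ((h p hp (dvd_mul_right p a)).mul_right a),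
      mul_assoc, mul_comm a p]

theorem unitaryCyclotomic_eq_prod_cyclotomic_kernel_mul {n : ℕ} (hn : 0 < n) :
    unitaryCyclotomic n = ∏ d ∈ (n / kernel n).divisors, cyclotomic (kernel n * d) ℂ := by
  have hκ : kernel n ∣ n := (kernel_dvd_iff hn.ne' n).2 fun _ _ h => h
  set ζ := Complex.exp (2 * Real.pi * Complex.I / n) with hζ_def
  have hζ : IsPrimitiveRoot ζ n := Complex.isPrimitiveRoot_exp n hn.ne'
  have hfin : IsOfFinOrder ζ := hζ.isOfFinOrder hn.ne'
  have horder (j : ℕ) : orderOf (ζ ^ j) = n / n.gcd j := by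
    rw [hfin.orderOf_pow, ← hζ.eq_orderOf]
  have hexp (j : ℕ) :
      Complex.exp (2 * (Real.pi : ℂ) * Complex.I * (j : ℂ) / (n : ℂ)) = ζ ^ j := by
    rw [hζ_def, ← Complex.exp_nat_mul]
    congr 1
    ring
  simp_rw [unitaryCyclotomic, hexp, unitaryGcd_eq_one_iff_kernel_dvd hn.ne', ← horder]
  have hcyc : ∀ d ∈ (n / kernel n).divisors, cyclotomic (kernel n * d) ℂ =
      ∏ z ∈ primitiveRoots (kernel n * d) ℂ, (X - C z) := fun d hd =>
    cyclotomic_eq_prod_X_sub_primitiveRoots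
      (Complex.isPrimitiveRoot_exp _
        (mul_pos (kernel_pos n) (Nat.pos_of_mem_divisors hd)).ne')
  rw [Finset.prod_congr rfl hcyc, Finset.prod_sigma']
  refine Finset.prod_bij
    (fun j _ => (⟨orderOf (ζ ^ j) / kernel n, ζ ^ j⟩ : Σ _ : ℕ, ℂ)) ?_ ?_ ?_ ?_
  · intro j hj
    obtain ⟨-, hdvd⟩ := Finset.mem_filter.1 hj
    have hordn : orderOf (ζ ^ j) ∣ n := by
      rw [horder]
      exact Nat.div_dvd_of_dvd (Nat.gcd_dvd_left n j)
    have hord_pos : 0 < orderOf (ζ ^ j) := Nat.pos_of_dvd_of_pos hordn hn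
    refine Finset.mem_sigma.2 ⟨Nat.mem_divisors.2 ⟨Nat.div_dvd_div hdvd hordn, ?_⟩, ?_⟩
    · exact (Nat.div_pos (Nat.le_of_dvd hn hκ) (kernel_pos n)).ne'
    · simp only
      rw [Nat.mul_div_cancel' hdvd, mem_primitiveRoots hord_pos]
      exact IsPrimitiveRoot.orderOf _
  · intro i hi j hj hij
    have hpow : ζ ^ i = ζ ^ j := by
      simp only [Sigma.mk.injEq, heq_eq_eq] at hij
      exact hij.2
    have hmod : i ≡ j [MOD n] := by
      rw [hζ.eq_orderOf]
      exact hfin.pow_eq_pow_iff_modEq.1 hpow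
    have hi := Finset.mem_Icc.1 (Finset.mem_filter.1 hi).1
    have hj := Finset.mem_Icc.1 (Finset.mem_filter.1 hj).1
    rcases le_total i j with h | h
    · have := Nat.eq_zero_of_dvd_of_lt ((Nat.modEq_iff_dvd' h).1 hmod) (by omega)
      omega
    · have := Nat.eq_zero_of_dvd_of_lt ((Nat.modEq_iff_dvd' h).1 hmod.symm) (by omega)
      omega
  · rintro ⟨d, z⟩ hdz
    obtain ⟨hd, hz⟩ := Finset.mem_sigma.1 hdz
    simp only at hd hz
    have hz := isPrimitiveRoot_of_mem_primitiveRoots hz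
    have hdn : kernel n * d ∣ n :=
      Nat.mul_dvd_of_dvd_div hκ (Nat.dvd_of_mem_divisors hd)
    have := NeZero.of_pos hn
    obtain ⟨i, hi, hzi⟩ := hζ.eq_pow_of_pow_eq_one ((hz.pow_eq_one_iff_dvd n).2 hdn)
    obtain ⟨j, hj, hzj⟩ : ∃ j ∈ Finset.Icc 1 n, ζ ^ j = z := by
      rcases Nat.eq_zero_or_pos i with rfl | hpos
      · exact ⟨n, Finset.mem_Icc.2 ⟨hn, le_rfl⟩, by rw [hζ.pow_eq_one, ← hzi, pow_zero]⟩
      · exact ⟨i, Finset.mem_Icc.2 ⟨hpos, hi.le⟩, hzi⟩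
    have hord : orderOf (ζ ^ j) = kernel n * d := by rw [hzj, ← hz.eq_orderOf]
    refine ⟨j, Finset.mem_filter.2 ⟨hj, hord ▸ dvd_mul_right _ _⟩, ?_⟩
    rw [hord, Nat.mul_div_cancel_left _ (kernel_pos n), hzj]
  · intro j _
    rfl

/-- `Φ*_n(x) = ∏_{d ∣ n/κ(n)} Φ_{κ(n)}(x^d)`. -/
theorem unitaryCyclotomic_eq_prod_cyclotomic_kernel_comp (n : ℕ) (hn : 0 < n) :
    unitaryCyclotomic n =
      ∏ d ∈ (n / kernel n).divisors, (Polynomial.cyclotomic (kernel n) ℂ).comp (X ^ d) := by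
  have hκ : kernel n ∣ n := (kernel_dvd_iff hn.ne' n).2 fun _ _ h => h
  rw [unitaryCyclotomic_eq_prod_cyclotomic_kernel_mul hn]
  refine Finset.prod_congr rfl fun d hd => (cyclotomic_comp_X_pow _ ?_ fun p hp hpd => ?_).symm
  · exact (Nat.pos_of_mem_divisors hd).ne'
  · have hdn : d ∣ n := (Nat.dvd_of_mem_divisors hd).trans (Nat.div_dvd_of_dvd hκ)
    exact (kernel_dvd_iff hn.ne' _).1 dvd_rfl p hp (hpd.trans hdn)
end

section
/- For every integer n > 1, the unitary cyclotomic polynomial Φ*_n is self-reciprocal: x^{φ*(n)} · Φ*_n(1/x) = Φ*_n(x); equivalently, the coefficient of x^j in Φ*_n equals the coefficient of x^{φ*(n)−j} for every 0 ≤ j ≤ φ*(n). -/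
open Polynomial Finset

theorem unitaryGcd_sub {j n : ℕ} (hj : j ≤ n) (hn : n ≠ 0) (h : unitaryGcd j n = 1) :
    unitaryGcd (n - j) n = 1 := by
  rw [unitaryGcd_eq_one_iff hn] at h ⊢
  intro d hd hdj
  refine h d hd ?_
  have hdn : d ∣ n := Nat.dvd_of_mem_divisors (mem_filter.1 hd).1
  rwa [Nat.dvd_sub_iff_right hj hdn] at hdj

theorem lt_of_unitaryGcd_eq_one {j n : ℕ} (hn : 1 < n) (hj : j ≤ n) (h : unitaryGcd j n = 1) :
    j < n := by
  refine lt_of_le_of_ne hj ?_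
  rintro rfl
  have := (unitaryGcd_eq_one_iff (by omega)).1 h j
    (by simp [unitaryDivisors, Nat.div_self (by omega : 0 < j)]; omega) dvd_rfl
  omega

theorem sub_mem_filter_unitaryGcd {j n : ℕ} (hn : 1 < n)
    (hj : j ∈ (Finset.Icc 1 n).filter fun j => unitaryGcd j n = 1) :
    n - j ∈ (Finset.Icc 1 n).filter fun j => unitaryGcd j n = 1 := by
  simp only [mem_filter, mem_Icc] at hj ⊢
  have := lt_of_unitaryGcd_eq_one hn hj.1.2 hj.2
  exact ⟨by omega, unitaryGcd_sub hj.1.2 (by omega) hj.2⟩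

theorem exp_sub_eq_inv {j n : ℕ} (hn : n ≠ 0) (hj : j ≤ n) :
    Complex.exp (2 * (Real.pi : ℂ) * Complex.I * ((n - j : ℕ) : ℂ) / (n : ℂ)) =
      (Complex.exp (2 * (Real.pi : ℂ) * Complex.I * (j : ℂ) / (n : ℂ)))⁻¹ := by
  have hn' : (n : ℂ) ≠ 0 := Nat.cast_ne_zero.2 hn
  rw [← Complex.exp_neg, Nat.cast_sub hj, mul_sub, sub_div, mul_div_cancel_right₀ _ hn',
    Complex.exp_sub, Complex.exp_two_pi_mul_I, one_div, Complex.exp_neg]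

theorem exp_half_eq_neg_one {j n : ℕ} (hn : n ≠ 0) (h : n = 2 * j) :
    Complex.exp (2 * (Real.pi : ℂ) * Complex.I * (j : ℂ) / (n : ℂ)) = -1 := by
  have hj : (j : ℂ) ≠ 0 := Nat.cast_ne_zero.2 (by omega)
  rw [← Complex.exp_pi_mul_I]
  congr 1
  rw [h]
  push_cast
  field_simp

theorem reverse_prod_of_domain {R ι : Type*} [CommRing R] [IsDomain R] (s : Finset ι)
    (f : ι → R[X]) : (∏ i ∈ s, f i).reverse = ∏ i ∈ s, (f i).reverse := by
  classical
  induction s using Finset.induction_on with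
  | empty => simpa using reverse_C (1 : R)
  | insert a s ha ih => rw [prod_insert ha, prod_insert ha, reverse_mul_of_domain, ih]

theorem reverse_X_sub_C {K : Type*} [Field K] {a : K} (ha : a ≠ 0) :
    (X - C a).reverse = C (-a) * (X - C a⁻¹) := by
  have h : (C (-a) * (X - C a⁻¹) : K[X]) = C 1 * X ^ 0 + C (-a) * X ^ 1 := by
    rw [mul_sub, ← C_mul, neg_mul, mul_inv_cancel₀ ha]
    simp
    ring
  have h' : (X - C a : K[X]) = C 1 * X ^ 1 + C (-a) * X ^ 0 := by simp [sub_eq_add_neg]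
  rw [h, reverse, natDegree_X_sub_C, h', reflect_add, reflect_C_mul_X_pow, reflect_C_mul_X_pow,
    revAt_le le_rfl, revAt_le zero_le_one, Nat.sub_self, Nat.sub_zero]

theorem reverse_unitaryCyclotomic {n : ℕ} (hn : 1 < n) :
    (unitaryCyclotomic n).reverse = unitaryCyclotomic n := by
  have hn0 : n ≠ 0 := by omega
  rw [unitaryCyclotomic, reverse_prod_of_domain]
  simp_rw [reverse_X_sub_C (Complex.exp_ne_zero _)]
  rw [prod_mul_distrib, ← map_prod]
  have hle : ∀ j ∈ (Finset.Icc 1 n).filter fun j => unitaryGcd j n = 1, j ≤ n := fun j hj =>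
    (mem_Icc.1 (mem_filter.1 hj).1).2
  have hconst : ∏ j ∈ (Finset.Icc 1 n).filter fun j => unitaryGcd j n = 1,
      -Complex.exp (2 * (Real.pi : ℂ) * Complex.I * (j : ℂ) / (n : ℂ)) = 1 := by
    refine prod_involution (fun j _ => n - j) (fun j hj => ?_) (fun j hj hne heq => hne ?_)
      (fun j hj => sub_mem_filter_unitaryGcd hn hj) (fun j hj => Nat.sub_sub_self (hle j hj))
    · rw [exp_sub_eq_inv hn0 (hle j hj), neg_mul_neg, mul_inv_cancel₀ (Complex.exp_ne_zero _)]
    · have := hle j hj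
      rw [exp_half_eq_neg_one hn0 (by omega), neg_neg]
  rw [hconst, C_1, one_mul]
  refine prod_bij' (fun j _ => n - j) (fun j _ => n - j)
    (fun j hj => sub_mem_filter_unitaryGcd hn hj)
    (fun j hj => sub_mem_filter_unitaryGcd hn hj) (fun j hj => Nat.sub_sub_self (hle j hj))
    (fun j hj => Nat.sub_sub_self (hle j hj)) (fun j hj => ?_)
  rw [exp_sub_eq_inv hn0 (hle j hj)]

theorem natDegree_unitaryCyclotomic (n : ℕ) :
    (unitaryCyclotomic n).natDegree = unitaryTotient n := by
  rw [unitaryCyclotomic, natDegree_finsetProd_X_sub_C_eq_card, unitaryTotient]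

/-- `Φ*_n` is self-reciprocal for `n > 1`:
the coefficient of `x^j` equals the coefficient of `x^{φ*(n) - j}` for `0 ≤ j ≤ φ*(n)`. -/
theorem unitaryCyclotomic_selfReciprocal (n : ℕ) (hn : 1 < n) (j : ℕ)
    (hj : j ≤ unitaryTotient n) :
    (unitaryCyclotomic n).coeff j = (unitaryCyclotomic n).coeff (unitaryTotient n - j) := by
  conv_lhs => rw [← reverse_unitaryCyclotomic hn]
  rw [coeff_reverse, natDegree_unitaryCyclotomic, revAt_le hj]
end

section
/- Let g, g* : ℕ → ℂ be arithmetic functions such that ∑_{d ∣ n} g(d) = ∑_{d ∣∣ n} g*(d) for every positive integer n. Then for every positive integer n one has g*(n) = ∑_{d ∣ n, κ(d) = κ(n)} g(d) and g(n) = ∑_{d ∣ n, κ(d) = κ(n)} g*(d) μ(n/d), where μ is the Möbius function. -/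
open Polynomial Finset

theorem mem_unitaryDivisors {d n : ℕ} :
    d ∈ unitaryDivisors n ↔ (d ∣ n ∧ n ≠ 0) ∧ Nat.Coprime d (n / d) := by
  rw [unitaryDivisors, Finset.mem_filter, Nat.mem_divisors]

theorem self_mem_unitaryDivisors {n : ℕ} (hn : n ≠ 0) : n ∈ unitaryDivisors n := by
  simp [mem_unitaryDivisors, hn, Nat.div_self (Nat.pos_of_ne_zero hn)]

/-- A unitary divisor absorbs every divisor supported on its primes. -/
theorem dvd_of_mem_unitaryDivisors {d e n : ℕ} (he : e ∈ unitaryDivisors n) (hd : d ∣ n)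
    (hde : d.primeFactors ⊆ e.primeFactors) : d ∣ e := by
  obtain ⟨⟨hen, hn⟩, hcop⟩ := mem_unitaryDivisors.1 he
  have hd0 : d ≠ 0 := ne_zero_of_dvd_ne_zero hn hd
  have hq : n / e ≠ 0 := (Nat.div_ne_zero_iff_of_dvd hen).2 ⟨hn, ne_zero_of_dvd_ne_zero hn hen⟩
  have hdcop : Nat.Coprime d (n / e) :=
    (Nat.disjoint_primeFactors hd0 hq).1 (hcop.disjoint_primeFactors.mono_left hde)
  exact hdcop.dvd_of_dvd_mul_right (by rwa [Nat.mul_div_cancel' hen])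

theorem eq_of_mem_unitaryDivisors {d e n : ℕ} (hd : d ∈ unitaryDivisors n)
    (he : e ∈ unitaryDivisors n) (hde : d.primeFactors = e.primeFactors) : d = e :=
  Nat.dvd_antisymm
    (dvd_of_mem_unitaryDivisors he (mem_unitaryDivisors.1 hd).1.1 hde.subset)
    (dvd_of_mem_unitaryDivisors hd (mem_unitaryDivisors.1 he).1.1 hde.symm.subset)

/-- The set of primes dividing a divisor `d` of `n` supports the unitary divisor `gcd (n, d ^ n)`
of `n`. -/
theorem gcd_pow_mem_unitaryDivisors {n : ℕ} (d : ℕ) (hn : n ≠ 0) :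
    n.gcd (d ^ n) ∈ unitaryDivisors n := by
  refine mem_unitaryDivisors.2 ⟨⟨Nat.gcd_dvd_left _ _, hn⟩, ?_⟩
  refine Nat.coprime_of_dvd fun p hp hpe hpq => ?_
  have hpd : p ∣ d := hp.dvd_of_dvd_pow (hpe.trans (Nat.gcd_dvd_right _ _))
  have hpow : p ^ n.factorization p ∣ n.gcd (d ^ n) :=
    Nat.dvd_gcd (Nat.ordProj_dvd n p)
      ((pow_dvd_pow p (Nat.factorization_lt p hn).le).trans (pow_dvd_pow_of_dvd hpd n))
  have hdvd := mul_dvd_mul hpow hpq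
  rw [Nat.mul_div_cancel' (Nat.gcd_dvd_left _ _)] at hdvd
  exact Nat.pow_succ_factorization_not_dvd hn hp (by rwa [pow_succ])

theorem primeFactors_gcd_pow {d n : ℕ} (hn : n ≠ 0) (hd : d ∣ n) :
    (n.gcd (d ^ n)).primeFactors = d.primeFactors := by
  have hd0 : d ≠ 0 := ne_zero_of_dvd_ne_zero hn hd
  rw [Nat.primeFactors_gcd hn (pow_ne_zero _ hd0), Nat.primeFactors_pow _ hn]
  exact Finset.inter_eq_right.2 (Nat.primeFactors_mono hd hn)

/-- Grouping the divisors of `n` by their set of primes. -/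
theorem sum_divisors_eq_sum_unitaryDivisors {M : Type*} [AddCommMonoid M] (f : ℕ → M) {n : ℕ}
    (hn : n ≠ 0) :
    ∑ d ∈ n.divisors, f d =
      ∑ e ∈ unitaryDivisors n, ∑ d ∈ e.divisors.filter fun d => kernel d = kernel e, f d := by
  rw [← Finset.sum_fiberwise_of_maps_to (t := unitaryDivisors n) (g := fun d => n.gcd (d ^ n))
    fun d _ => gcd_pow_mem_unitaryDivisors d hn]
  refine Finset.sum_congr rfl fun e he => Finset.sum_congr ?_ fun _ _ => rfl
  have hen := (mem_unitaryDivisors.1 he).1.1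
  ext d
  simp only [Finset.mem_filter, Nat.mem_divisors, kernel_eq_kernel_iff]
  constructor
  · rintro ⟨⟨hd, -⟩, rfl⟩
    exact ⟨⟨Nat.dvd_gcd hd (dvd_pow_self d hn), ne_zero_of_dvd_ne_zero hn hen⟩,
      (primeFactors_gcd_pow hn hd).symm⟩
  · rintro ⟨⟨hd, -⟩, hk⟩
    exact ⟨⟨hd.trans hen, hn⟩, eq_of_mem_unitaryDivisors (gcd_pow_mem_unitaryDivisors d hn) he
      ((primeFactors_gcd_pow hn (hd.trans hen)).trans hk)⟩

/-- A function on the positive integers is determined by its sums over unitary divisors. -/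
theorem eq_of_sum_unitaryDivisors_eq {M : Type*} [AddCancelCommMonoid M] {f g : ℕ → M}
    (h : ∀ n : ℕ, 0 < n → ∑ d ∈ unitaryDivisors n, f d = ∑ d ∈ unitaryDivisors n, g d)
    {n : ℕ} (hn : 0 < n) : f n = g n := by
  induction n using Nat.strong_induction_on with
  | _ n ih =>
    have hself := self_mem_unitaryDivisors hn.ne'
    have hsum := h n hn
    rw [← Finset.add_sum_erase _ _ hself, ← Finset.add_sum_erase _ g hself,
      Finset.sum_congr rfl fun d hd => ?_] at hsum
    · exact add_right_cancel hsum
    · obtain ⟨hne, hd⟩ := Finset.mem_erase.1 hd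
      have hdn := (mem_unitaryDivisors.1 hd).1.1
      exact ih d ((Nat.le_of_dvd hn hdn).lt_of_ne hne) (Nat.pos_of_dvd_of_pos hdn hn)

/-- Möbius inversion among the integers with a given kernel. -/
theorem eq_sum_mul_moebius_of_eq_sum_kernel {R : Type*} [CommRing R] {f F : ℕ → R}
    (hF : ∀ n : ℕ, 0 < n → F n = ∑ d ∈ n.divisors.filter fun d => kernel d = kernel n, f d)
    {n : ℕ} (hn : 0 < n) :
    f n = ∑ d ∈ n.divisors.filter fun d => kernel d = kernel n,
      F d * ((ArithmeticFunction.moebius (n / d) : ℤ) : R) := by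
  have hinv := (ArithmeticFunction.sum_eq_iff_sum_mul_moebius_eq_on
    (f := fun d => if kernel d = kernel n then f d else 0)
    (g := fun d => if kernel d = kernel n then F d else 0)
    {d | d ∣ n} fun _ _ hde he => dvd_trans hde he).1 ?_ n hn dvd_rfl
  · rw [Nat.sum_divisorsAntidiagonal' fun a b =>
      ((ArithmeticFunction.moebius a : ℤ) : R) * if kernel b = kernel n then F b else 0] at hinv
    rw [Finset.sum_filter]
    simpa [mul_comm] using hinv.symm
  · intro m hm hmn
    by_cases hk : kernel m = kernel n
    · simp only [hk, if_true]
      rw [hF m hm, Finset.sum_filter, hk]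
    · simp only [hk, if_false]
      refine Finset.sum_eq_zero fun d hd => if_neg fun hdk => hk ?_
      rw [kernel_eq_kernel_iff] at hdk ⊢
      exact (Nat.primeFactors_mono hmn hn.ne').antisymm
        (hdk ▸ Nat.primeFactors_mono (Nat.dvd_of_mem_divisors hd) hm.ne')

/-- if `∑_{d ∣ n} g(d) = ∑_{d ∣∣ n} g*(d)` for all `n ≥ 1`, then
`g*(n) = ∑_{d ∣ n, κ(d) = κ(n)} g(d)` and `g(n) = ∑_{d ∣ n, κ(d) = κ(n)} g*(d) μ(n/d)`. -/
theorem unitary_kernel_inversion (g gstar : ℕ → ℂ)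
    (h : ∀ n : ℕ, 0 < n → ∑ d ∈ n.divisors, g d = ∑ d ∈ unitaryDivisors n, gstar d) :
    ∀ n : ℕ, 0 < n →
      (gstar n = ∑ d ∈ n.divisors.filter fun d => kernel d = kernel n, g d) ∧
      (g n = ∑ d ∈ n.divisors.filter fun d => kernel d = kernel n,
        gstar d * ((ArithmeticFunction.moebius (n / d) : ℤ) : ℂ)) := by
  have hstar : ∀ n : ℕ, 0 < n →
      gstar n = ∑ d ∈ n.divisors.filter fun d => kernel d = kernel n, g d :=
    fun n hn => eq_of_sum_unitaryDivisors_eq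
      (g := fun n => ∑ d ∈ n.divisors.filter fun d => kernel d = kernel n, g d)
      (fun m hm => by rw [← h m hm, sum_divisors_eq_sum_unitaryDivisors g hm.ne']) hn
  exact fun n hn => ⟨hstar n hn, eq_sum_mul_moebius_of_eq_sum_kernel hstar hn⟩
end

section
/- For every positive integer n: Φ*_n(1) = 0 if n = 1; Φ*_n(1) = p^e if n = p^e is a prime power with p prime and e ≥ 1; and Φ*_n(1) = 1 otherwise (i.e., if n has at least two distinct prime factors). -/
open Polynomial Finset

/-- The unitary gcd is `1` exactly when `n / gcd (n, j)` keeps all the prime factors of `n`. -/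
theorem unitaryGcd_eq_one_iff_s9 {n : ℕ} (hn : n ≠ 0) (j : ℕ) :
    unitaryGcd j n = 1 ↔ (n / n.gcd j).primeFactors = n.primeFactors := by
  have hg : n.gcd j ∣ n := Nat.gcd_dvd_left n j
  have hq : n / n.gcd j ∣ n := Nat.div_dvd_of_dvd hg
  have hall : unitaryGcd j n = 1 ↔ ∀ d ∈ unitaryDivisors n, d ∣ j → d = 1 := by
    have hone : 1 ≤ unitaryGcd j n :=
      Finset.le_sup (f := id) (b := 1) (by simp [unitaryDivisors, hn])
    rw [← hone.ge_iff_eq', unitaryGcd, Finset.sup_le_iff]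
    constructor
    · intro h d hd hdj
      have hpos : 0 < d := Nat.pos_of_mem_divisors (Finset.mem_filter.1 hd).1
      have hle : d ≤ 1 := h d (Finset.mem_filter.2 ⟨hd, hdj⟩)
      omega
    · intro h d hd
      exact (h d (Finset.mem_filter.1 hd).1 (Finset.mem_filter.1 hd).2).le
  rw [hall]
  constructor
  · intro h
    refine (Nat.primeFactors_mono hq hn).antisymm fun p hp => ?_
    have hpp := Nat.prime_of_mem_primeFactors hp
    have hpn := Nat.dvd_of_mem_primeFactors hp
    refine Nat.mem_primeFactors.2 ⟨hpp, ?_, ne_zero_of_dvd_ne_zero hn hq⟩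
    by_contra hpq
    have hcop : Nat.Coprime (p ^ n.factorization p) (n / n.gcd j) :=
      ((Nat.Prime.coprime_iff_not_dvd hpp).2 hpq).pow_left _
    have hdvd : p ^ n.factorization p ∣ n.gcd j :=
      hcop.dvd_of_dvd_mul_right ((Nat.mul_div_cancel' hg).symm ▸ Nat.ordProj_dvd n p)
    have hd := h (p ^ n.factorization p)
      (by
        rw [unitaryDivisors, Finset.mem_filter, Nat.mem_divisors]
        exact ⟨⟨Nat.ordProj_dvd n p, hn⟩, (Nat.coprime_ordCompl hpp hn).pow_left _⟩)
      (hdvd.trans (Nat.gcd_dvd_right n j))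
    have hpd : p ∣ p ^ n.factorization p :=
      dvd_pow_self p (hpp.factorization_pos_of_dvd hn hpn).ne'
    exact hpp.one_lt.ne' (Nat.dvd_one.1 (hd ▸ hpd))
  · intro h d hd hdj
    obtain ⟨hdn, hcop⟩ := Finset.mem_filter.1 hd
    have hdn := Nat.dvd_of_mem_divisors hdn
    by_contra hd1
    obtain ⟨p, hpp, hpd⟩ := Nat.exists_prime_and_dvd hd1
    have hpq : p ∣ n / n.gcd j :=
      Nat.dvd_of_mem_primeFactors (h ▸ Nat.mem_primeFactors.2 ⟨hpp, hpd.trans hdn, hn⟩)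
    have hqd : n / n.gcd j ∣ n / d := Nat.div_dvd_div_left hg (Nat.dvd_gcd hdn hdj)
    exact Nat.not_coprime_of_dvd_of_dvd hpp.one_lt hpd (hpq.trans hqd) hcop

/-- `Φ*_n` is the product of the cyclotomic polynomials `Φ_d` over the divisors `d` of `n` having
the same prime factors as `n`. -/
theorem unitaryCyclotomic_eq_prod_cyclotomic_s9 {n : ℕ} (hn : n ≠ 0) :
    unitaryCyclotomic n =
      ∏ d ∈ n.divisors with d.primeFactors = n.primeFactors, cyclotomic d ℂ := by
  have hζ := Complex.isPrimitiveRoot_exp n hn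
  set ζ := Complex.exp (2 * Real.pi * Complex.I / n) with hζdef
  have hexp (j : ℕ) : Complex.exp (2 * (Real.pi : ℂ) * Complex.I * (j : ℂ) / (n : ℂ)) = ζ ^ j := by
    rw [hζdef, ← Complex.exp_nat_mul]
    ring_nf
  have horder (j : ℕ) : orderOf (ζ ^ j) = n / n.gcd j := by
    rw [(hζ.isOfFinOrder hn).orderOf_pow, ← hζ.eq_orderOf]
  simp only [unitaryCyclotomic, hexp, unitaryGcd_eq_one_iff_s9 hn, ← horder]
  rw [← Finset.prod_fiberwise_of_maps_to (g := fun j => orderOf (ζ ^ j))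
    (t := {d ∈ n.divisors | d.primeFactors = n.primeFactors})]
  · refine Finset.prod_congr rfl fun d hd => ?_
    obtain ⟨hdn, hdp⟩ := Finset.mem_filter.1 hd
    have hdn := Nat.dvd_of_mem_divisors hdn
    have hd0 : 0 < d := Nat.pos_of_dvd_of_pos hdn (Nat.pos_of_ne_zero hn)
    have hprim : IsPrimitiveRoot (ζ ^ (n / d)) d :=
      hζ.pow (Nat.pos_of_ne_zero hn) (Nat.div_mul_cancel hdn).symm
    rw [cyclotomic_eq_prod_X_sub_primitiveRoots hprim]
    refine Finset.prod_bij (fun j _ => ζ ^ j) ?_ ?_ ?_ fun _ _ => rfl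
    · intro j hj
      rw [mem_primitiveRoots hd0, ← (Finset.mem_filter.1 hj).2]
      exact IsPrimitiveRoot.orderOf _
    · intro a ha b hb hab
      simp only [Finset.mem_filter, Finset.mem_Icc] at ha hb
      have hmod : a ≡ b [MOD n] := by
        rw [hζ.eq_orderOf]
        exact (hζ.isOfFinOrder hn).pow_eq_pow_iff_modEq.1 hab
      rcases le_total a b with hle | hle
      · have hdvd := (Nat.modEq_iff_dvd' hle).1 hmod
        have := Nat.eq_zero_of_dvd_of_lt hdvd (by omega)
        omega
      · have hdvd := (Nat.modEq_iff_dvd' hle).1 hmod.symm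
        have := Nat.eq_zero_of_dvd_of_lt hdvd (by omega)
        omega
    · intro z hz
      rw [mem_primitiveRoots hd0] at hz
      have hzn : z ^ n = 1 := (hz.pow_eq_one_iff_dvd n).2 hdn
      have : NeZero n := ⟨hn⟩
      obtain ⟨j, hj, hjz⟩ : ∃ j ∈ Finset.Icc 1 n, ζ ^ j = z := by
        obtain ⟨i, hi, hiz⟩ := hζ.eq_pow_of_pow_eq_one hzn
        rcases Nat.eq_zero_or_pos i with rfl | hi0
        · exact ⟨n, Finset.mem_Icc.2 ⟨by omega, le_rfl⟩, by rw [hζ.pow_eq_one, ← hiz, pow_zero]⟩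
        · exact ⟨i, Finset.mem_Icc.2 ⟨hi0, hi.le⟩, hiz⟩
      have hjd : orderOf (ζ ^ j) = d := by rw [hjz, hz.eq_orderOf]
      exact ⟨j, Finset.mem_filter.2 ⟨Finset.mem_filter.2 ⟨hj, hjd ▸ hdp⟩, hjd⟩, hjz⟩
  · intro j hj
    rw [Finset.mem_filter, Nat.mem_divisors]
    exact ⟨⟨horder j ▸ Nat.div_dvd_of_dvd (Nat.gcd_dvd_left n j), hn⟩, (Finset.mem_filter.1 hj).2⟩

/-- values of `Φ*_n(1)`. -/
theorem unitaryCyclotomic_eval_one (n : ℕ) (hn : 0 < n) :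
    (n = 1 → Polynomial.eval 1 (unitaryCyclotomic n) = 0) ∧
    (∀ p e : ℕ, p.Prime → 1 ≤ e → n = p ^ e →
      Polynomial.eval 1 (unitaryCyclotomic n) = (p : ℂ) ^ e) ∧
    (n ≠ 1 → (∀ p e : ℕ, p.Prime → 1 ≤ e → n ≠ p ^ e) →
      Polynomial.eval 1 (unitaryCyclotomic n) = 1) := by
  have hprod := unitaryCyclotomic_eq_prod_cyclotomic_s9 hn.ne'
  refine ⟨?_, ?_, ?_⟩
  · rintro rfl
    simp [hprod, Finset.filter_singleton]
  · rintro p e hp he rfl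
    have hset : {d ∈ (p ^ e).divisors | d.primeFactors = (p ^ e).primeFactors} =
        (Finset.range e).image fun i => p ^ (i + 1) := by
      ext d
      simp only [Finset.mem_filter, Nat.mem_divisors, Nat.dvd_prime_pow hp, Finset.mem_image,
        Finset.mem_range, Nat.primeFactors_prime_pow (by omega : e ≠ 0) hp]
      constructor
      · rintro ⟨⟨⟨_ | k, hk, rfl⟩, -⟩, hd⟩
        · simp at hd
        · exact ⟨k, hk, rfl⟩
      · rintro ⟨k, hk, rfl⟩
        exact ⟨⟨⟨k + 1, hk, rfl⟩, hn.ne'⟩, Nat.primeFactors_prime_pow k.succ_ne_zero hp⟩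
    have : Fact p.Prime := ⟨hp⟩
    rw [hprod, hset, Finset.prod_image, eval_prod]
    · simp [eval_one_cyclotomic_prime_pow]
    · intro a _ b _ hab
      simpa using Nat.pow_right_injective hp.two_le hab
  · intro hn1 hnp
    rw [hprod, eval_prod]
    refine Finset.prod_eq_one fun d hd => eval_one_cyclotomic_not_prime_pow fun {p} hp k hk => ?_
    have hd := (Finset.mem_filter.1 hd).2
    rcases Nat.eq_zero_or_pos k with rfl | hkpos
    · rw [← hk, pow_zero, Nat.primeFactors_one, eq_comm, Nat.primeFactors_eq_empty] at hd
      omega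
    · rw [← hk, Nat.primeFactors_prime_pow hkpos.ne' hp] at hd
      obtain ⟨q, e, hq, he, hqe⟩ := (isPrimePow_nat_iff n).1
        (isPrimePow_iff_card_primeFactors_eq_one.2 (by rw [← hd, Finset.card_singleton]))
      exact hnp q e hq he hqe.symm
end

section
/- For every integer n ≥ 2: (i) ∏_{1 ≤ j ≤ n, (j,n)_* = 1} sin(πj/n) = Φ*_n(1) / 2^{φ*(n)}, and (ii) Φ*_n(−1) = (−2i)^{φ*(n)} · ∏_{1 ≤ j ≤ n, (j,n)_* = 1} cos(πj/n); in particular, when φ*(n) is even, ∏_{1 ≤ j ≤ n, (j,n)_* = 1} cos(πj/n) = Φ*_n(−1) / (−4)^{φ*(n)/2}. -/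
open Polynomial Finset

/-- Reflection `j ↦ n - j` preserves the greatest unitary divisor. -/
theorem unitaryGcd_sub_self {j n : ℕ} (hj : j ≤ n) : unitaryGcd (n - j) n = unitaryGcd j n := by
  unfold unitaryGcd
  congr 1
  refine Finset.filter_congr fun d hd => ?_
  have hdn : d ∣ n := Nat.dvd_of_mem_divisors (Finset.mem_filter.mp hd).1
  exact ⟨fun h => (Nat.dvd_sub_iff_right hj hdn).mp h, fun h => Nat.dvd_sub hdn h⟩

theorem unitaryGcd_self_ne_one {n : ℕ} (hn : 2 ≤ n) : unitaryGcd n n ≠ 1 := by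
  have hmem : n ∈ (unitaryDivisors n).filter fun d => d ∣ n := by
    simp [unitaryDivisors, Nat.div_self (show 0 < n by omega), show n ≠ 0 by omega]
  have hle : n ≤ unitaryGcd n n := Finset.le_sup (f := id) hmem
  omega

theorem two_mul_sum_unitaryGcd_eq_one {n : ℕ} (hn : 2 ≤ n) :
    2 * ∑ j ∈ (Finset.Icc 1 n).filter (fun j => unitaryGcd j n = 1), j =
      unitaryTotient n * n := by
  have hlt : ∀ j ∈ (Finset.Icc 1 n).filter (fun j => unitaryGcd j n = 1), 1 ≤ j ∧ j < n := by
    intro j hj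
    obtain ⟨hj, h⟩ := Finset.mem_filter.mp hj
    rw [Finset.mem_Icc] at hj
    refine ⟨hj.1, lt_of_le_of_ne hj.2 ?_⟩
    rintro rfl
    exact unitaryGcd_self_ne_one hn h
  have hmaps : ∀ j ∈ (Finset.Icc 1 n).filter (fun j => unitaryGcd j n = 1),
      n - j ∈ (Finset.Icc 1 n).filter (fun j => unitaryGcd j n = 1) := by
    intro j hj
    have h := hlt j hj
    rw [Finset.mem_filter, unitaryGcd_sub_self h.2.le, Finset.mem_Icc]
    exact ⟨by omega, (Finset.mem_filter.mp hj).2⟩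
  have hreflect : ∑ j ∈ (Finset.Icc 1 n).filter (fun j => unitaryGcd j n = 1), j =
      ∑ j ∈ (Finset.Icc 1 n).filter (fun j => unitaryGcd j n = 1), (n - j) := by
    refine Finset.sum_nbij' (fun j => n - j) (fun j => n - j) hmaps hmaps ?_ ?_ ?_ <;>
      intro j hj <;> have := hlt j hj <;> omega
  rw [two_mul]
  nth_rewrite 2 [hreflect]
  rw [← Finset.sum_add_distrib, Finset.sum_congr rfl fun j hj => show j + (n - j) = n by
    have := hlt j hj
    omega]
  simp [unitaryTotient]

theorem prod_exp_unitaryGcd_eq_one {n : ℕ} (hn : 2 ≤ n) :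
    ∏ j ∈ (Finset.Icc 1 n).filter (fun j => unitaryGcd j n = 1),
      Complex.exp ((Real.pi * j / n : ℂ) * Complex.I) = Complex.I ^ unitaryTotient n := by
  have hn0 : (n : ℂ) ≠ 0 := Nat.cast_ne_zero.mpr (by omega)
  have hsum : 2 * ∑ j ∈ (Finset.Icc 1 n).filter (fun j => unitaryGcd j n = 1), (j : ℂ) =
      unitaryTotient n * n := by
    have h := congrArg (Nat.cast (R := ℂ)) (two_mul_sum_unitaryGcd_eq_one hn)
    push_cast at h
    exact h
  rw [← Complex.exp_sum, ← Finset.sum_mul, ← Finset.sum_div, ← Finset.mul_sum,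
    div_mul_eq_mul_div]
  have h_arg : (Real.pi * ∑ j ∈ (Finset.Icc 1 n).filter (fun j => unitaryGcd j n = 1), (j : ℂ)) *
      Complex.I / n = unitaryTotient n * (Real.pi / 2 * Complex.I) := by
    field_simp
    linear_combination hsum
  rw [h_arg, Complex.exp_nat_mul, Complex.exp_pi_div_two_mul_I]

theorem one_sub_exp_two_mul_I (z : ℂ) :
    1 - Complex.exp (2 * z * Complex.I) =
      -2 * Complex.I * Complex.exp (z * Complex.I) * Complex.sin z := by
  rw [mul_assoc 2, two_mul, Complex.exp_add, Complex.exp_mul_I]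
  linear_combination Complex.sin z ^ 2 * Complex.I_sq
    - Complex.sin_sq_add_cos_sq z

theorem neg_one_sub_exp_two_mul_I (z : ℂ) :
    -1 - Complex.exp (2 * z * Complex.I) =
      -2 * Complex.exp (z * Complex.I) * Complex.cos z := by
  rw [mul_assoc 2, two_mul, Complex.exp_add, Complex.exp_mul_I]
  linear_combination -Complex.sin z ^ 2 * Complex.I_sq + Complex.sin_sq_add_cos_sq z

theorem eval_one_unitaryCyclotomic {n : ℕ} (hn : 2 ≤ n) :
    (unitaryCyclotomic n).eval 1 = 2 ^ unitaryTotient n *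
      ∏ j ∈ (Finset.Icc 1 n).filter (fun j => unitaryGcd j n = 1),
        Complex.sin (Real.pi * j / n) := by
  have hfactor (j : ℕ) : (X - C (Complex.exp (2 * Real.pi * Complex.I * j / n))).eval 1 =
      -2 * Complex.I * Complex.exp (Real.pi * j / n * Complex.I) *
        Complex.sin (Real.pi * j / n) := by
    rw [← one_sub_exp_two_mul_I, eval_sub, eval_X, eval_C]
    ring_nf
  simp_rw [unitaryCyclotomic, eval_prod, hfactor, Finset.prod_mul_distrib]
  rw [prod_exp_unitaryGcd_eq_one hn, ← Finset.prod_mul_distrib, Finset.prod_const,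
    ← unitaryTotient, ← mul_pow]
  congr 2
  linear_combination -2 * Complex.I_sq

theorem eval_neg_one_unitaryCyclotomic {n : ℕ} (hn : 2 ≤ n) :
    (unitaryCyclotomic n).eval (-1) = (-2 * Complex.I) ^ unitaryTotient n *
      ∏ j ∈ (Finset.Icc 1 n).filter (fun j => unitaryGcd j n = 1),
        Complex.cos (Real.pi * j / n) := by
  have hfactor (j : ℕ) : (X - C (Complex.exp (2 * Real.pi * Complex.I * j / n))).eval (-1) =
      -2 * Complex.exp (Real.pi * j / n * Complex.I) * Complex.cos (Real.pi * j / n) := by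
    rw [← neg_one_sub_exp_two_mul_I, eval_sub, eval_X, eval_C]
    ring_nf
  simp_rw [unitaryCyclotomic, eval_prod, hfactor, Finset.prod_mul_distrib]
  rw [prod_exp_unitaryGcd_eq_one hn, Finset.prod_const, ← unitaryTotient, ← mul_pow]

/-- products of sines and cosines over `(j, n)_* = 1` for `n ≥ 2`. -/
theorem unitary_sin_cos_products (n : ℕ) (hn : 2 ≤ n) :
    ((((∏ j ∈ (Finset.Icc 1 n).filter fun j => unitaryGcd j n = 1,
          Real.sin (Real.pi * j / n)) : ℝ) : ℂ) =
        Polynomial.eval 1 (unitaryCyclotomic n) / 2 ^ unitaryTotient n) ∧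
    (Polynomial.eval (-1) (unitaryCyclotomic n) =
        (-2 * Complex.I) ^ unitaryTotient n *
          (((∏ j ∈ (Finset.Icc 1 n).filter fun j => unitaryGcd j n = 1,
            Real.cos (Real.pi * j / n)) : ℝ) : ℂ)) ∧
    (Even (unitaryTotient n) →
      ((((∏ j ∈ (Finset.Icc 1 n).filter fun j => unitaryGcd j n = 1,
          Real.cos (Real.pi * j / n)) : ℝ) : ℂ) =
        Polynomial.eval (-1) (unitaryCyclotomic n) / (-4) ^ (unitaryTotient n / 2))) := by
  have hcos := eval_neg_one_unitaryCyclotomic hn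
  push_cast
  refine ⟨?_, hcos, fun heven => ?_⟩
  · rw [eval_one_unitaryCyclotomic hn, mul_div_cancel_left₀ _ (by simp)]
  · have hpow : (-2 * Complex.I) ^ unitaryTotient n = (-4) ^ (unitaryTotient n / 2) := by
      rw [← Nat.two_mul_div_two_of_even heven, pow_mul, Nat.mul_div_cancel_left _ two_pos,
        mul_pow, Complex.I_sq]
      norm_num
    rw [hcos, hpow, mul_div_cancel_left₀ _ (by simp)]
end
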